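/- For every closed subset K of the circle S¹ there exists a C^∞ function f : S¹ → ℝ whose zero set is exactly K; consequently, for any two closed sets K', K'' ⊂ S¹ there is a measure-preserving C^∞ diffeomorphism H of the torus T² with Fix(H) = K' × K''. -/

import Mathlib

open MeasureTheory

/-- A closed subset of the circle is the zero set of a smooth function with values in `[0, 1)`. -/
theorem AddCircle.exists_contDiff_preimage_zero_eq {K : Set (AddCircle (1 : ℝ))}
    (hK : IsClosed K) :
    ∃ f : AddCircle (1 : ℝ) → ℝ, Continuous f ∧
      ContDiff ℝ (⊤ : ℕ∞) (fun x : ℝ => f (x : AddCircle (1 : ℝ))) ∧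
      (∀ x, f x ∈ Set.Ico 0 1) ∧ f ⁻¹' {0} = K := by
  let e : AddCircle (1 : ℝ) → ℂ := fun x => (AddCircle.toCircle x : ℂ)
  have he : Continuous e := continuous_subtype_val.comp AddCircle.continuous_toCircle
  have hinj : Function.Injective e :=
    Subtype.val_injective.comp (AddCircle.injective_toCircle one_ne_zero)
  have hcl : IsClosed (e '' K) := (hK.isCompact.image he).isClosed
  obtain ⟨h, hsupp, hsmooth, hrange⟩ :=
    hcl.isOpen_compl.exists_contDiff_support_eq (n := (⊤ : ℕ∞))
  refine ⟨fun x => h (e x) / 2, (hsmooth.continuous.comp he).div_const 2, ?_, fun x => ?_, ?_⟩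
  · have hexp : ContDiff ℝ (⊤ : ℕ∞) (fun x : ℝ => e (x : AddCircle (1 : ℝ))) := by
      have : (fun x : ℝ => e (x : AddCircle (1 : ℝ))) =
          fun x : ℝ => Complex.exp ((2 * Real.pi / 1 * x : ℝ) * Complex.I) := by
        ext x
        simp only [e, AddCircle.toCircle_apply_mk, Circle.coe_exp]
      rw [this]
      exact ((Complex.ofRealCLM.contDiff.comp (contDiff_const.mul contDiff_id)).mul
        contDiff_const).cexp
    exact (hsmooth.comp hexp).div_const 2
  · obtain ⟨h0, h1⟩ := hrange (Set.mem_range_self (e x))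
    constructor <;> linarith
  · ext x
    have hx : h (e x) ≠ 0 ↔ e x ∉ e '' K := by
      rw [← Function.mem_support, hsupp, Set.mem_compl_iff]
    rw [hinj.mem_set_image] at hx
    simpa using not_iff_not.mp hx

/-- The shear `(x, y) ↦ (x, y + φ x)` of the square of an additive group. -/
@[simps]
def Equiv.shearSnd {G : Type*} [AddGroup G] (φ : G → G) : G × G ≃ G × G where
  toFun p := (p.1, p.2 + φ p.1)
  invFun p := (p.1, p.2 - φ p.1)
  left_inv p := by simp
  right_inv p := by simp

theorem measurePreserving_shearSnd {φ : AddCircle (1 : ℝ) → AddCircle (1 : ℝ)}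
    (hφ : Measurable φ) : MeasurePreserving (Equiv.shearSnd φ) volume volume :=
  (MeasurePreserving.id volume).skew_product
    (g := fun x y => y + φ x) (by fun_prop)
    (Filter.Eventually.of_forall fun x => map_add_right_eq_self volume (φ x))

/-- For every closed subset `K` of the circle there is a `C^∞` function
`f : S¹ → ℝ` whose zero set is exactly `K`; consequently, for any two closed
sets `K', K'' ⊆ S¹` there is a measure-preserving `C^∞` diffeomorphism `H` of
the torus (a composition of two shears, induced by smooth `1`-periodic lifts)
with `Fix(H) = K' × K''`. -/
theorem smooth_zero_set_and_torus_diffeo :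
    (∀ K : Set (AddCircle (1 : ℝ)), IsClosed K →
      ∃ f : AddCircle (1 : ℝ) → ℝ,
        (∃ F : ℝ → ℝ, ContDiff ℝ (⊤ : ℕ∞) F ∧ ∀ x : ℝ, f (x : AddCircle (1 : ℝ)) = F x) ∧
        f ⁻¹' {0} = K) ∧
    (∀ K' K'' : Set (AddCircle (1 : ℝ)), IsClosed K' → IsClosed K'' →
      ∃ (H : (AddCircle (1 : ℝ) × AddCircle (1 : ℝ)) ≃
              (AddCircle (1 : ℝ) × AddCircle (1 : ℝ)))
        (f g : ℝ → ℝ),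
          ContDiff ℝ (⊤ : ℕ∞) f ∧ ContDiff ℝ (⊤ : ℕ∞) g ∧
          Function.Periodic f 1 ∧ Function.Periodic g 1 ∧
          (∀ x y : ℝ, H ((x : AddCircle (1 : ℝ)), (y : AddCircle (1 : ℝ))) =
            (((x + f y : ℝ) : AddCircle (1 : ℝ)),
             ((y + g (x + f y) : ℝ) : AddCircle (1 : ℝ)))) ∧
          MeasurePreserving H volume volume ∧
          {p | H p = p} = K' ×ˢ K'') := by
  refine ⟨fun K hK => ?_, fun K' K'' hK' hK'' => ?_⟩
  · obtain ⟨f, -, hf, -, hfK⟩ := AddCircle.exists_contDiff_preimage_zero_eq hK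
    exact ⟨f, ⟨_, hf, fun _ => rfl⟩, hfK⟩
  · obtain ⟨f, hfc, hf, hf01, hfK⟩ := AddCircle.exists_contDiff_preimage_zero_eq hK''
    obtain ⟨g, hgc, hg, hg01, hgK⟩ := AddCircle.exists_contDiff_preimage_zero_eq hK'
    let φ : AddCircle (1 : ℝ) → AddCircle (1 : ℝ) := fun y => (f y : ℝ)
    let γ : AddCircle (1 : ℝ) → AddCircle (1 : ℝ) := fun x => (g x : ℝ)
    have hφ : Measurable φ := ((AddCircle.continuous_mk' 1).comp hfc).measurable
    have hγ : Measurable γ := ((AddCircle.continuous_mk' 1).comp hgc).measurable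
    have hswap : MeasurePreserving
        (Equiv.prodComm (AddCircle (1 : ℝ)) (AddCircle (1 : ℝ))) volume volume :=
      Measure.measurePreserving_swap
    refine ⟨(Equiv.prodComm _ _).trans ((Equiv.shearSnd φ).trans
        ((Equiv.prodComm _ _).trans (Equiv.shearSnd γ))),
      fun y => f y, fun x => g x, hf, hg, fun y => ?_, fun x => ?_, fun x y => ?_, ?_, ?_⟩
    · simp only [AddCircle.coe_add_period]
    · simp only [AddCircle.coe_add_period]
    · simp [φ, γ]
    · exact (measurePreserving_shearSnd hγ).comp
        (hswap.comp ((measurePreserving_shearSnd hφ).comp hswap))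
    · ext ⟨x, y⟩
      have hy : φ y = 0 ↔ y ∈ K'' := by
        rw [← hfK]
        exact AddCircle.coe_eq_zero_iff_of_mem_Ico (hf01 y)
      have hx : γ x = 0 ↔ x ∈ K' := by
        rw [← hgK]
        exact AddCircle.coe_eq_zero_iff_of_mem_Ico (hg01 x)
      simp only [Set.mem_ofPred_eq, Equiv.trans_apply, Equiv.prodComm_apply, Equiv.shearSnd_apply,
        Prod.swap_prod_mk, Prod.mk.injEq, add_eq_left, Set.mem_prod, ← hx, ← hy]
      constructor
      · rintro ⟨h1, h2⟩
        exact ⟨by simpa [h1] using h2, h1⟩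
      · rintro ⟨h1, h2⟩
        simp [h1, h2]
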